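/- arXiv:1709.01983 — 3 statements merged into one kernel-verified Lean document; each statement's English description precedes it below -/
import Mathlib

section
/- Let α ≥ 4 be real and b > 1/2. There exists C > 0 (depending only on α and b) such that for every measurable g : ℝ³ → ℂ with ‖⟨τ + φ(ξ, μ)⟩^{b} g(ξ, μ, τ)‖_{L²(ℝ³)} < ∞, the function u whose space–time Fourier transform is g satisfies ‖ |D_x|^{(α−2)/8} u ‖_{L⁴(ℝ³)} ≤ C ‖⟨τ + φ(ξ, μ)⟩^{b} g‖_{L²(ℝ³)}, where |D_x|^{(α−2)/8} u is the function with Fourier transform |ξ|^{(α−2)/8} g(ξ, μ, τ). (Paper's Lemma 2.3, a Strichartz-type estimate.) -/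
open MeasureTheory FourierTransform

/-- The generalized KP-I dispersion relation `φ(ξ, μ) = ξ|ξ|^α + μ²/ξ`. -/
noncomputable def phi (α ξ μ : ℝ) : ℝ := ξ * |ξ| ^ α + μ ^ 2 / ξ

theorem continuous_fourier_of_integrable {V : Type*} [NormedAddCommGroup V]
    [InnerProductSpace ℝ V] [FiniteDimensional ℝ V] [MeasurableSpace V] [BorelSpace V] {f : V → ℂ}
    (hf : Integrable f) : Continuous (𝓕 f) :=
  VectorFourier.fourierIntegral_continuous Real.continuous_fourierChar
    (by exact continuous_inner) hf

/-- The `L²` isometry property of the Fourier integral on `L¹ ∩ L²`. -/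
theorem eLpNorm_fourier_eq {V : Type*} [NormedAddCommGroup V] [InnerProductSpace ℝ V]
    [FiniteDimensional ℝ V] [MeasurableSpace V] [BorelSpace V] {f : V → ℂ}
    (hf : Integrable f) (hf2 : MemLp f 2) :
    eLpNorm (𝓕 f) 2 = eLpNorm f 2 := by
  have key : 𝓕 f =ᵐ[volume] (𝓕 (hf2.toLp f) : Lp (α := V) ℂ 2 volume) := by
    apply ae_eq_of_integral_contDiff_smul_eq
    · exact (continuous_fourier_of_integrable hf).locallyIntegrable
    · exact (Lp.memLp _).locallyIntegrable (by norm_num)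
    · intro g g_smooth g_cpt
      have hg₁ : HasCompactSupport (Complex.ofRealCLM ∘ g) := g_cpt.comp_left rfl
      have hg₂ : ContDiff ℝ (⊤ : ℕ∞) (Complex.ofRealCLM ∘ g) :=
        Complex.ofRealCLM.contDiff.comp g_smooth
      set G := hg₁.toSchwartzMap hg₂ with hG
      have h1 := congrArg (fun T => T G) (Lp.fourier_toTemperedDistribution_eq (hf2.toLp f))
      simp only [TemperedDistribution.fourier_apply, Lp.toTemperedDistribution_apply] at h1
      have h2 : ∫ x, (𝓕 G) x • (hf2.toLp f) x = ∫ x, (𝓕 G) x • f x := by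
        apply integral_congr_ae
        filter_upwards [hf2.coeFn_toLp] with x hx
        rw [hx]
      have h3 := VectorFourier.integral_fourierIntegral_smul_eq_flip (μ := volume) (ν := volume)
        (L := innerₗ V) Real.continuous_fourierChar (by exact continuous_inner)
        G.integrable hf
      have h4 : ∀ x, (G x : ℂ) = (g x : ℂ) := fun x => by simp [hG]
      rw [h2] at h1
      simp only [flip_innerₗ] at h3
      have h5 : ∫ x, (𝓕 G) x • f x = ∫ x, G x • 𝓕 f x := h3
      calc ∫ x, g x • 𝓕 f x = ∫ x, G x • 𝓕 f x := by simp [h4]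
        _ = _ := by rw [← h5, h1]
        _ = _ := by simp [h4]
  rw [eLpNorm_congr_ae key, ← Lp.enorm_def, ← eLpNorm_congr_ae hf2.coeFn_toLp, ← Lp.enorm_def]
  rw [← ofReal_norm, ← ofReal_norm, Lp.norm_fourier_eq]

theorem eLpNorm_fourierInv_eq_eLpNorm_fourier {V : Type*} [NormedAddCommGroup V]
    [InnerProductSpace ℝ V] [FiniteDimensional ℝ V] [MeasurableSpace V] [BorelSpace V]
    {f : V → ℂ} (hf : Integrable f) (p : ENNReal) :
    eLpNorm (𝓕⁻ f) p = eLpNorm (𝓕 f) p := by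
  have h : 𝓕⁻ f = 𝓕 f ∘ Neg.neg := by
    ext w; simp [Real.fourierInv_eq_fourier_neg]
  rw [h]
  refine eLpNorm_comp_measurePreserving ?_ (Measure.measurePreserving_neg volume)
  exact (continuous_fourier_of_integrable hf).aestronglyMeasurable

open Convolution in
theorem eLpNorm_fourier_four_le {V : Type*} [NormedAddCommGroup V] [InnerProductSpace ℝ V]
    [FiniteDimensional ℝ V] [MeasurableSpace V] [BorelSpace V] {f : V → ℂ}
    (hf : Integrable f) :
    eLpNorm (𝓕 f) 4 ^ 4 ≤ ∫⁻ p, (∫⁻ q, ‖f q‖ₑ * ‖f (p - q)‖ₑ) ^ 2 := by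
  set F := f ⋆[ContinuousLinearMap.mul ℂ ℂ] f with hF
  have hFi : Integrable F := hf.integrable_convolution _ hf
  have hle : ∀ p, ‖F p‖ₑ ≤ ∫⁻ q, ‖f q‖ₑ * ‖f (p - q)‖ₑ := fun p => by
    refine (enorm_integral_le_lintegral_enorm _).trans (le_of_eq ?_)
    simp
  have hn4 : eLpNorm (𝓕 f) 4 ^ 4 = ∫⁻ x, ‖𝓕 f x‖ₑ ^ 4 := by
    have := eLpNorm_nnreal_pow_eq_lintegral (f := 𝓕 f) (μ := volume) (p := 4) (by norm_num)
    norm_num at this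
    exact_mod_cast this
  have hn2 : ∀ u : V → ℂ, eLpNorm u 2 ^ 2 = ∫⁻ x, ‖u x‖ₑ ^ 2 := fun u => by
    have := eLpNorm_nnreal_pow_eq_lintegral (f := u) (μ := volume) (p := 2) (by norm_num)
    norm_num at this
    exact_mod_cast this
  by_cases htop : ∫⁻ p, (∫⁻ q, ‖f q‖ₑ * ‖f (p - q)‖ₑ) ^ 2 = ⊤
  · simp [htop]
  have hF2le : eLpNorm F 2 ^ 2 ≤ ∫⁻ p, (∫⁻ q, ‖f q‖ₑ * ‖f (p - q)‖ₑ) ^ 2 := by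
    rw [hn2]
    exact lintegral_mono fun p => by gcongr; exact hle p
  have hF2 : MemLp F 2 := by
    refine ⟨hFi.aestronglyMeasurable, ?_⟩
    by_contra h
    have : eLpNorm F 2 = ⊤ := by simpa using h
    rw [this] at hF2le
    simp at hF2le
    exact htop hF2le
  refine le_trans (le_of_eq ?_) hF2le
  rw [← eLpNorm_fourier_eq hFi hF2, hn2, hn4]
  refine lintegral_congr fun x => ?_
  rw [hF, Real.fourier_mul_convolution_eq hf hf, enorm_mul]
  ring

theorem lintegral_comp_mul_sq {κ : ℝ} (hκ : 0 < κ) {F : ℝ → ENNReal} (hF : Measurable F) :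
    ∫⁻ y, F (κ * y ^ 2) = ENNReal.ofReal (√κ)⁻¹ * ∫⁻ r, F r * ENNReal.ofReal (√r)⁻¹ := by
  have himg : (fun y : ℝ => κ * y ^ 2) '' Set.Ioi 0 = Set.Ioi 0 := by
    ext r
    simp only [Set.mem_image, Set.mem_Ioi]
    constructor
    · rintro ⟨y, hy, rfl⟩; positivity
    · intro hr
      exact ⟨√(r / κ), by positivity, by rw [Real.sq_sqrt (by positivity)]; field_simp⟩
  have hinj : Set.InjOn (fun y : ℝ => κ * y ^ 2) (Set.Ioi 0) := by
    intro x hx y hy h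
    simp only [Set.mem_Ioi] at hx hy
    have : x ^ 2 = y ^ 2 := mul_left_cancel₀ hκ.ne' h
    exact (pow_left_inj₀ hx.le hy.le two_ne_zero).1 this
  have hder : ∀ x ∈ Set.Ioi (0 : ℝ),
      HasDerivWithinAt (fun y : ℝ => κ * y ^ 2) (κ * (2 * x)) (Set.Ioi 0) x := fun x _ => by
    have := ((hasDerivAt_pow 2 x).const_mul κ).hasDerivWithinAt (s := Set.Ioi 0)
    simpa using this
  have hcv := lintegral_image_eq_lintegral_abs_deriv_mul measurableSet_Ioi hder hinj
    (fun r => ENNReal.ofReal (√κ)⁻¹ * (F r * ENNReal.ofReal (√r)⁻¹))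
  rw [himg] at hcv
  have hpos : ∫⁻ r, F r * ENNReal.ofReal (√r)⁻¹ =
      ∫⁻ r in Set.Ioi 0, F r * ENNReal.ofReal (√r)⁻¹ := by
    rw [← lintegral_indicator measurableSet_Ioi]
    refine lintegral_congr fun r => ?_
    by_cases hr : 0 < r
    · simp [hr]
    · simp [Real.sqrt_eq_zero_of_nonpos (not_lt.1 hr), hr]
  rw [hpos, ← lintegral_const_mul _ (by fun_prop), hcv]
  have h2 : ∫⁻ x in Set.Ioi 0, ENNReal.ofReal |κ * (2 * x)| *
      (ENNReal.ofReal (√κ)⁻¹ * (F (κ * x ^ 2) * ENNReal.ofReal (√(κ * x ^ 2))⁻¹)) =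
      ∫⁻ x in Set.Ioi 0, 2 * F (κ * x ^ 2) := by
    refine setLIntegral_congr_fun measurableSet_Ioi fun x (hx : 0 < x) => ?_
    have : ENNReal.ofReal |κ * (2 * x)| * ENNReal.ofReal (√κ)⁻¹ *
        ENNReal.ofReal (√(κ * x ^ 2))⁻¹ = 2 := by
      rw [← ENNReal.ofReal_mul (by positivity), ← ENNReal.ofReal_mul (by positivity),
        abs_of_pos (by positivity), Real.sqrt_mul hκ.le, Real.sqrt_sq hx.le]
      have hs : √κ ^ 2 = κ := Real.sq_sqrt hκ.le
      have : κ * (2 * x) * (√κ)⁻¹ * (√κ * x)⁻¹ = 2 := by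
        have : √κ ≠ 0 := by positivity
        field_simp
        rw [hs]
      rw [this]; simp
    calc _ = ENNReal.ofReal |κ * (2 * x)| * ENNReal.ofReal (√κ)⁻¹ *
        ENNReal.ofReal (√(κ * x ^ 2))⁻¹ * F (κ * x ^ 2) := by ring
      _ = _ := by rw [this]
  rw [h2, lintegral_const_mul _ (by fun_prop), two_mul,
    ← lintegral_add_compl _ (measurableSet_Ioi (a := (0 : ℝ)))]
  congr 1
  rw [Set.compl_Ioi, ← restrict_Iio_eq_restrict_Iic]
  have := (Measure.measurePreserving_neg (volume : Measure ℝ)).setLIntegral_comp_preimage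
    (measurableSet_Ioi (a := (0 : ℝ))) (f := fun x => F (κ * x ^ 2)) (by fun_prop)
  simpa using this

theorem lintegral_inv_sqrt_sub (a : ℝ) :
    ∫⁻ y in Set.Ioo 0 a, ENNReal.ofReal (√(a - y))⁻¹ ≤ ENNReal.ofReal (2 * √a) := by
  have h1 : ∫⁻ y in Set.Ioo 0 a, ENNReal.ofReal (√(a - y))⁻¹ =
      ∫⁻ r, (Set.Ioo 0 a).indicator 1 r * ENNReal.ofReal (√r)⁻¹ := by
    rw [← lintegral_indicator measurableSet_Ioo,
      ← lintegral_sub_left_eq_self _ a]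
    refine lintegral_congr fun r => ?_
    by_cases hr : r ∈ Set.Ioo 0 a
    · have : a - r ∈ Set.Ioo 0 a := ⟨by linarith [hr.2], by linarith [hr.1]⟩
      simp only [hr, this, Set.indicator_of_mem]
      simp
    · have : a - r ∉ Set.Ioo 0 a := fun h => hr ⟨by linarith [h.2], by linarith [h.1]⟩
      simp [hr, this]
  have h2 := lintegral_comp_mul_sq one_pos
    (F := (Set.Ioo 0 a).indicator 1) (measurable_one.indicator measurableSet_Ioo)
  simp only [Real.sqrt_one, inv_one, ENNReal.ofReal_one, one_mul] at h2
  rw [h1, ← h2]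
  have hm : MeasurableSet (Set.Ioo (-√a) √a) := measurableSet_Ioo
  calc _ ≤ ∫⁻ y, (Set.Ioo (-√a) √a).indicator 1 y := by
        refine lintegral_mono fun y => ?_
        by_cases hy : y ^ 2 ∈ Set.Ioo 0 a
        · have : y ∈ Set.Ioo (-√a) √a := abs_lt.1 (Real.lt_sqrt_of_sq_lt (by rw [sq_abs]; exact hy.2))
          simp [hy, this]
        · simp [hy]
    _ = _ := by
        rw [lintegral_indicator_one hm, Real.volume_Ioo]; congr 1; ring

/-- If `H` grows at least like `c y²` on `(0, m)`, then `(r - H)₊^{-1/2}` has integral at most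
`2 / √c`, uniformly in `r`. -/
theorem lintegral_inv_sqrt_sub_le {c m r : ℝ} (hc : 0 < c) {H : ℝ → ℝ}
    (hH : ∀ y y', 0 < y → y ≤ y' → y' < m → c * (y' ^ 2 - y ^ 2) ≤ H y' - H y) :
    ∫⁻ y in Set.Ioo 0 m, ENNReal.ofReal (√(r - H y))⁻¹ ≤ ENNReal.ofReal (2 / √c) := by
  set S := {y | y ∈ Set.Ioo 0 m ∧ H y < r} with hS
  rcases S.eq_empty_or_nonempty with he | ⟨z, hz⟩
  · have : ∫⁻ y in Set.Ioo 0 m, ENNReal.ofReal (√(r - H y))⁻¹ = 0 := by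
      rw [setLIntegral_congr_fun measurableSet_Ioo (g := 0)]
      · simp
      · intro y hy
        have : ¬ H y < r := fun h => (he ▸ (show y ∈ S from ⟨hy, h⟩) : y ∈ (∅ : Set ℝ))
        simp [Real.sqrt_eq_zero_of_nonpos (show r - H y ≤ 0 by linarith)]
    simp [this]
  have hbdd : BddAbove S := ⟨m, fun y hy => hy.1.2.le⟩
  set a := sSup S
  have ha0 : 0 < a := hz.1.1.trans_le (le_csSup hbdd hz)
  have hbound : ∀ y ∈ S, c * (a ^ 2 - y ^ 2) ≤ r - H y := by
    intro y hy
    have h1 : a ≤ √(y ^ 2 + (r - H y) / c) := by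
      refine csSup_le ⟨z, hz⟩ fun y' hy' => Real.le_sqrt_of_sq_le ?_
      rcases le_total y y' with h | h
      · have := hH y y' hy.1.1 h hy'.1.2
        have h3 := hy'.2
        rw [← sub_le_iff_le_add', le_div_iff₀ hc]
        linarith
      · have : y' ^ 2 ≤ y ^ 2 := pow_le_pow_left₀ hy'.1.1.le h 2
        have : 0 ≤ (r - H y) / c := div_nonneg (by linarith [hy.2]) hc.le
        linarith
    have hnn : 0 ≤ y ^ 2 + (r - H y) / c :=
      add_nonneg (sq_nonneg _) (div_nonneg (by linarith [hy.2]) hc.le)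
    have := (Real.le_sqrt ha0.le hnn).1 h1
    rw [← sub_le_iff_le_add', le_div_iff₀ hc] at this
    linarith
  have hpt : ∀ᵐ y, (Set.Ioo 0 m).indicator (fun y => ENNReal.ofReal (√(r - H y))⁻¹) y ≤
      (Set.Ioo 0 a).indicator
        (fun y => ENNReal.ofReal (√(c * a))⁻¹ * ENNReal.ofReal (√(a - y))⁻¹) y := by
    have hne : ∀ᵐ y : ℝ, y ≠ a := by simp [ae_iff]
    filter_upwards [hne] with y hya
    by_cases hy : y ∈ Set.Ioo 0 m
    swap
    · simp [hy]
    by_cases hyr : H y < r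
    swap
    · simp [hy, Real.sqrt_eq_zero_of_nonpos (show r - H y ≤ 0 by linarith)]
    have hyS : y ∈ S := ⟨hy, hyr⟩
    have hlt : y < a := lt_of_le_of_ne (le_csSup hbdd hyS) hya
    have hya' : y ∈ Set.Ioo 0 a := ⟨hy.1, hlt⟩
    rw [Set.indicator_of_mem hy, Set.indicator_of_mem hya', ← ENNReal.ofReal_mul (by positivity),
      ← mul_inv, ← Real.sqrt_mul (by positivity)]
    have hay : 0 < a - y := by linarith
    apply ENNReal.ofReal_le_ofReal
    apply inv_anti₀ (by positivity)
    apply Real.sqrt_le_sqrt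
    have h1 := hbound y hyS
    have h2 : 0 ≤ c * (a - y) * y := by have := hy.1; positivity
    nlinarith
  rw [← lintegral_indicator measurableSet_Ioo]
  refine (lintegral_mono_ae hpt).trans ?_
  rw [lintegral_indicator measurableSet_Ioo, lintegral_const_mul _ (by fun_prop)]
  refine (mul_le_mul_right (lintegral_inv_sqrt_sub a) _).trans (le_of_eq ?_)
  rw [← ENNReal.ofReal_mul (by positivity), Real.sqrt_mul hc.le]
  congr 1
  have : √a ≠ 0 := by positivity
  have : √c ≠ 0 := by positivity
  field_simp

theorem rpow_add_rpow_sub_growth {p m y y' : ℝ} (hp : 2 ≤ p) (hy : 0 < y) (hyy : y ≤ y')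
    (hm : y' < m) :
    m ^ (p - 2) * (y' ^ 2 - y ^ 2) ≤
      ((m + y') ^ p + (m - y') ^ p) - ((m + y) ^ p + (m - y) ^ p) := by
  have hm0 : 0 < m := by linarith
  have hd : ∀ z ∈ Set.Ioo 0 m, HasDerivAt
      (fun z => (m + z) ^ p + (m - z) ^ p - m ^ (p - 2) * z ^ 2)
      (p * (m + z) ^ (p - 1) - p * (m - z) ^ (p - 1) - m ^ (p - 2) * (2 * z)) z := by
    intro z hz
    have h1 := ((hasDerivAt_id z).const_add m).rpow_const (p := p)
      (Or.inl (by have := hz.1; simp; linarith))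
    have h2 := ((hasDerivAt_id z).const_sub m).rpow_const (p := p)
      (Or.inl (by have := hz.2; simp; linarith))
    have h3 := (hasDerivAt_pow 2 z).const_mul (m ^ (p - 2))
    convert! (h1.add h2).sub h3 using 1
    simp; ring
  have hmono : MonotoneOn (fun z => (m + z) ^ p + (m - z) ^ p - m ^ (p - 2) * z ^ 2)
      (Set.Ioo 0 m) := by
    apply monotoneOn_of_deriv_nonneg (convex_Ioo 0 m)
    · exact fun z hz => (hd z hz).continuousAt.continuousWithinAt
    · rw [interior_Ioo]
      exact fun z hz => (hd z hz).differentiableAt.differentiableWithinAt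
    · rw [interior_Ioo]
      intro z hz
      rw [(hd z hz).deriv]
      have hz0 := hz.1
      have hzm : 0 < m - z := by linarith [hz.2]
      have e : ∀ x : ℝ, 0 < x → x ^ (p - 1) = x ^ (p - 2) * x := fun x hx => by
        rw [← Real.rpow_add_one hx.ne']; congr 1; ring
      have h1 : m ^ (p - 2) * (m + z) ≤ (m + z) ^ (p - 1) := by
        rw [e _ (by linarith)]
        gcongr
        linarith
      have h2 : (m - z) ^ (p - 1) ≤ m ^ (p - 2) * (m - z) := by
        rw [e _ (by linarith)]
        gcongr
        linarith
      have h3 : 0 < m ^ (p - 2) := by positivity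
      have h4 : m ^ (p - 2) * (2 * z) ≤ (m + z) ^ (p - 1) - (m - z) ^ (p - 1) := by linarith
      have h5 : 0 < m ^ (p - 2) * (2 * z) := by positivity
      nlinarith
  have := hmono ⟨hy, by linarith⟩ ⟨by linarith, hm⟩ hyy
  simp only at this
  linarith

theorem setLIntegral_Ioo_le_add_reflect (m : ℝ) {G : ℝ → ENNReal} (hG : Measurable G) :
    ∫⁻ x in Set.Ioo 0 (2 * m), G x ≤
      (∫⁻ y in Set.Ioo 0 m, G (m + y)) + ∫⁻ y in Set.Ioo 0 m, G (m - y) := by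
  simp only [← lintegral_indicator measurableSet_Ioo]
  rw [← lintegral_sub_right_eq_self ((Set.Ioo 0 m).indicator fun y => G (m + y)) m,
    ← lintegral_sub_left_eq_self ((Set.Ioo 0 m).indicator fun y => G (m - y)) m,
    ← lintegral_add_left]
  · have hne : ∀ᵐ x : ℝ, x ≠ m := by simp [ae_iff]
    refine lintegral_mono_ae ?_
    filter_upwards [hne] with x hx
    by_cases h : x ∈ Set.Ioo 0 (2 * m)
    · rw [Set.indicator_of_mem h]
      rcases lt_or_gt_of_ne hx with hlt | hgt
      · have h1 : m - x ∈ Set.Ioo 0 m := ⟨by linarith, by linarith [h.1]⟩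
        rw [Set.indicator_of_mem h1]
        simp
      · have h1 : x - m ∈ Set.Ioo 0 m := ⟨by linarith, by linarith [h.2]⟩
        rw [Set.indicator_of_mem h1]
        simp
    · simp [h]
  · exact Measurable.comp (g := (Set.Ioo 0 m).indicator fun y => G (m + y))
      ((hG.comp (measurable_const_add m)).indicator measurableSet_Ioo) (measurable_sub_const m)

/-- Uniform bound for the interaction integral over two positive frequencies summing to `ξ`. -/
theorem lintegral_resonance_le {α ξ : ℝ} (hα : 4 ≤ α) (hξ : 0 < ξ) (A d : ℝ) {v : ℝ → ENNReal}
    (hv : Measurable v) :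
    ∫⁻ x in Set.Ioo 0 ξ, ENNReal.ofReal ((x * (ξ - x)) ^ ((α - 2) / 4)) *
        ∫⁻ y, v (A + (x ^ (α + 1) + (ξ - x) ^ (α + 1)) + ξ / (x * (ξ - x)) * (y - x * d) ^ 2) ≤
      ENNReal.ofReal (4 * 2 ^ ((α - 1) / 2)) * ∫⁻ s, v s := by
  set h : ℝ → ℝ := fun x => x ^ (α + 1) + (ξ - x) ^ (α + 1) with hh
  have hhm : Measurable h := by fun_prop
  have hpt : ∀ x ∈ Set.Ioo 0 ξ, ENNReal.ofReal ((x * (ξ - x)) ^ ((α - 2) / 4)) *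
        ∫⁻ y, v (A + h x + ξ / (x * (ξ - x)) * (y - x * d) ^ 2) ≤
      ENNReal.ofReal (ξ ^ ((α - 1) / 2)) *
        ∫⁻ r, v (A + r) * ENNReal.ofReal (√(r - h x))⁻¹ := by
    intro x hx
    have hx0 : 0 < x := hx.1
    have hx1 : 0 < ξ - x := by linarith [hx.2]
    rw [lintegral_sub_right_eq_self (fun y => v (A + h x + ξ / (x * (ξ - x)) * y ^ 2)) (x * d),
      lintegral_comp_mul_sq (F := fun s => v (A + h x + s)) (by positivity) (by fun_prop),
      ← mul_assoc, ← ENNReal.ofReal_mul (by positivity),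
      ← lintegral_sub_right_eq_self (fun r => v (A + h x + r) * ENNReal.ofReal (√r)⁻¹) (h x)]
    have e1 : ∀ r, A + h x + (r - h x) = A + r := fun r => by ring
    simp only [e1]
    gcongr
    have hle : x * (ξ - x) ≤ ξ ^ 2 := by nlinarith
    have hsq : (√(ξ / (x * (ξ - x))))⁻¹ ≤ ξ ^ (1 / 2 : ℝ) := by
      rw [← Real.sqrt_inv, ← Real.sqrt_eq_rpow]
      apply Real.sqrt_le_sqrt
      rw [inv_div, div_le_iff₀ hξ]
      nlinarith
    calc (x * (ξ - x)) ^ ((α - 2) / 4) * (√(ξ / (x * (ξ - x))))⁻¹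
        ≤ (ξ ^ 2) ^ ((α - 2) / 4) * ξ ^ (1 / 2 : ℝ) := by
          gcongr
          linarith
      _ = ξ ^ ((α - 1) / 2) := by
          rw [← Real.rpow_natCast, ← Real.rpow_mul hξ.le, ← Real.rpow_add hξ]
          congr 1
          push_cast
          ring
  have hinner : ∀ r, ∫⁻ x in Set.Ioo 0 ξ, ENNReal.ofReal (√(r - h x))⁻¹ ≤
      ENNReal.ofReal (4 / √((ξ / 2) ^ (α - 1))) := by
    intro r
    have hc : 0 < (ξ / 2) ^ (α - 1) := by positivity
    have h1 := setLIntegral_Ioo_le_add_reflect (ξ / 2)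
      (G := fun x => ENNReal.ofReal (√(r - h x))⁻¹) (by fun_prop)
    rw [mul_div_cancel₀ ξ two_ne_zero] at h1
    have e1 : ∀ y, h (ξ / 2 + y) = (ξ / 2 + y) ^ (α + 1) + (ξ / 2 - y) ^ (α + 1) := fun y => by
      simp only [hh]; congr 2; ring
    have e2 : ∀ y, h (ξ / 2 - y) = (ξ / 2 + y) ^ (α + 1) + (ξ / 2 - y) ^ (α + 1) := fun y => by
      simp only [hh]; rw [add_comm]; congr 2; ring
    simp only [e1, e2] at h1
    have h2 := lintegral_inv_sqrt_sub_le (m := ξ / 2) (r := r) hc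
      (H := fun y => (ξ / 2 + y) ^ (α + 1) + (ξ / 2 - y) ^ (α + 1)) (fun y y' hy hyy hm => by
        have := rpow_add_rpow_sub_growth (p := α + 1) (by linarith) hy hyy hm
        rwa [show α + 1 - 2 = α - 1 by ring] at this)
    refine h1.trans ((add_le_add h2 h2).trans (le_of_eq ?_))
    rw [← ENNReal.ofReal_add (by positivity) (by positivity)]
    congr 1
    ring
  refine (setLIntegral_mono' measurableSet_Ioo hpt).trans ?_
  have hmeas : Measurable (Function.uncurry fun x r : ℝ =>
      v (A + r) * ENNReal.ofReal (√(r - h x))⁻¹) := by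
    simp only [Function.uncurry_def]; fun_prop
  rw [lintegral_const_mul _ (Measurable.lintegral_prod_right hmeas),
    lintegral_lintegral_swap hmeas.aemeasurable]
  calc _ ≤ ENNReal.ofReal (ξ ^ ((α - 1) / 2)) *
        ∫⁻ r, v (A + r) * ENNReal.ofReal (4 / √((ξ / 2) ^ (α - 1))) := by
        gcongr with r
        rw [lintegral_const_mul _ (by fun_prop)]
        gcongr
        exact hinner r
    _ = _ := by
        rw [lintegral_mul_const _ (by fun_prop), lintegral_add_left_eq_self, mul_comm (∫⁻ s, v s),
          ← mul_assoc, ← ENNReal.ofReal_mul (by positivity)]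
        congr 2
        rw [Real.sqrt_eq_rpow, ← Real.rpow_mul (by positivity), Real.div_rpow hξ.le (by norm_num),
          show (α - 1) * (1 / 2) = (α - 1) / 2 by ring]
        have : ξ ^ ((α - 1) / 2) ≠ 0 := by positivity
        field_simp

theorem lintegral_euclideanSpace_fin_three {G : ℝ → ℝ → ℝ → ENNReal}
    (hG : Measurable fun z : ℝ × ℝ × ℝ => G z.1 z.2.1 z.2.2) :
    ∫⁻ q : EuclideanSpace ℝ (Fin 3), G (q 0) (q 1) (q 2) = ∫⁻ x, ∫⁻ y, ∫⁻ t, G x y t := by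
  have h1 := PiLp.volume_preserving_ofLp (Fin 3)
  have h2 := volume_preserving_piFinSuccAbove (fun _ : Fin 3 => ℝ) 0
  have h3 := (MeasurePreserving.id (volume : Measure ℝ)).prod (volume_preserving_finTwoArrow ℝ)
  have h := h3.comp (h2.comp h1)
  have e := h.lintegral_comp hG
  refine Eq.trans ?_ (e.trans ?_)
  · rfl
  · rw [lintegral_prod _ hG.aemeasurable]
    refine lintegral_congr fun x => ?_
    exact lintegral_prod (fun z : ℝ × ℝ => G x z.1 z.2) (by fun_prop)

/-- The weight `⟨s⟩^{-2b}`. -/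
noncomputable def modulationWeight (b s : ℝ) : ENNReal := ENNReal.ofReal ((1 + |s|) ^ (-(2 * b)))

theorem measurable_modulationWeight (b : ℝ) : Measurable (modulationWeight b) := by
  unfold modulationWeight
  fun_prop

theorem lintegral_modulationWeight_lt_top {b : ℝ} (hb : 1 / 2 < b) :
    ∫⁻ s, modulationWeight b s < ⊤ := by
  have := integrable_one_add_norm (E := ℝ) (μ := volume) (r := 2 * b) (by simp; linarith)
  exact this.lintegral_lt_top

/-- The multiplier `1_{ξ > 0} ξ^{(α-2)/4} ⟨τ + φ(ξ, μ)⟩^{-2b}`. -/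
noncomputable def posMultiplier (α b x y t : ℝ) : ENNReal :=
  (Set.Ioi 0).indicator (fun x => ENNReal.ofReal (x ^ ((α - 2) / 4))) x *
    modulationWeight b (t + phi α x y)

theorem measurable_posMultiplier (α b : ℝ) :
    Measurable fun z : ℝ × ℝ × ℝ => posMultiplier α b z.1 z.2.1 z.2.2 := by
  have h1 : Measurable ((Set.Ioi (0 : ℝ)).indicator
      (fun x => ENNReal.ofReal (x ^ ((α - 2) / 4)))) :=
    Measurable.indicator (by fun_prop) measurableSet_Ioi
  have h2 := measurable_modulationWeight b
  unfold posMultiplier phi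
  fun_prop

theorem phi_add_phi {α ξ x : ℝ} (hx : x ∈ Set.Ioo 0 ξ) (μ y : ℝ) :
    phi α x y + phi α (ξ - x) (μ - y) = μ ^ 2 / ξ + (x ^ (α + 1) + (ξ - x) ^ (α + 1)) +
      ξ / (x * (ξ - x)) * (y - x * (μ / ξ)) ^ 2 := by
  have h0 : 0 < x := hx.1
  have h1 : 0 < ξ - x := by linarith [hx.2]
  have h2 : ξ ≠ 0 := by linarith
  have h3 : ξ - x ≠ 0 := h1.ne'
  unfold phi
  rw [abs_of_pos h0, abs_of_pos h1, Real.rpow_add_one h0.ne', Real.rpow_add_one h1.ne']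
  have : y ^ 2 / x + (μ - y) ^ 2 / (ξ - x) =
      μ ^ 2 / ξ + ξ / (x * (ξ - x)) * (y - x * (μ / ξ)) ^ 2 := by
    field_simp
    ring
  linear_combination this

theorem lintegral_posMultiplier_le {α b : ℝ} (hα : 4 ≤ α) (ξ μ τ : ℝ) :
    ∫⁻ x, ∫⁻ y, ∫⁻ t, posMultiplier α b x y t * posMultiplier α b (ξ - x) (μ - y) (τ - t) ≤
      ENNReal.ofReal (4 * 2 ^ ((α - 1) / 2)) * (∫⁻ s, modulationWeight b s) ^ 2 := by
  set w := modulationWeight b with hw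
  have hwm : Measurable w := measurable_modulationWeight b
  set Q : ℝ → ℝ → ℝ := fun x y => (x ^ (α + 1) + (ξ - x) ^ (α + 1)) +
      ξ / (x * (ξ - x)) * (y - x * (μ / ξ)) ^ 2 with hQ
  have hQm : Measurable (Function.uncurry Q) := by
    simp only [hQ, Function.uncurry_def]; fun_prop
  have hstep : ∀ x, ∫⁻ y, ∫⁻ t,
      posMultiplier α b x y t * posMultiplier α b (ξ - x) (μ - y) (τ - t) =
      (Set.Ioo 0 ξ).indicator (fun x => ∫⁻ t, w t *
        (ENNReal.ofReal ((x * (ξ - x)) ^ ((α - 2) / 4)) *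
          ∫⁻ y, w (τ - t + μ ^ 2 / ξ + Q x y))) x := by
    intro x
    by_cases hx : x ∈ Set.Ioo 0 ξ
    swap
    · rw [Set.indicator_of_notMem hx]
      have : ∀ y t, posMultiplier α b x y t * posMultiplier α b (ξ - x) (μ - y) (τ - t) = 0 := by
        intro y t
        unfold posMultiplier
        by_cases h0 : 0 < x
        · have : ¬ x < ξ := fun h => hx ⟨h0, h⟩
          simp [this]
        · simp [h0]
      simp [this]
    have h0 : 0 < x := hx.1
    have h1 : 0 < ξ - x := by linarith [hx.2]
    rw [Set.indicator_of_mem hx]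
    have hin : ∀ y, ∫⁻ t,
        posMultiplier α b x y t * posMultiplier α b (ξ - x) (μ - y) (τ - t) =
        ∫⁻ t, w t * (ENNReal.ofReal ((x * (ξ - x)) ^ ((α - 2) / 4)) *
          w (τ - t + μ ^ 2 / ξ + Q x y)) := by
      intro y
      rw [← lintegral_sub_right_eq_self _ (phi α x y)]
      refine lintegral_congr fun t => ?_
      unfold posMultiplier
      rw [Set.indicator_of_mem (show x ∈ Set.Ioi 0 from h0),
        Set.indicator_of_mem (show ξ - x ∈ Set.Ioi 0 from h1), ← hw,
        Real.mul_rpow h0.le h1.le, ENNReal.ofReal_mul (by positivity)]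
      have e : τ - (t - phi α x y) + phi α (ξ - x) (μ - y) = τ - t + μ ^ 2 / ξ + Q x y := by
        have := phi_add_phi (α := α) hx μ y
        simp only [hQ]
        linarith
      rw [e, sub_add_cancel]
      ring
    simp only [hin]
    rw [lintegral_lintegral_swap]
    · refine lintegral_congr fun t => ?_
      rw [lintegral_const_mul _ (by fun_prop), lintegral_const_mul _ (by fun_prop)]
    · simp only [Function.uncurry_def]
      exact Measurable.aemeasurable (by fun_prop)
  simp only [hstep]
  rw [lintegral_indicator measurableSet_Ioo, lintegral_lintegral_swap]
  · calc _ ≤ ∫⁻ t, w t * (ENNReal.ofReal (4 * 2 ^ ((α - 1) / 2)) * ∫⁻ s, w s) := by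
          refine lintegral_mono fun t => ?_
          rw [lintegral_const_mul]
          · gcongr
            rcases le_or_gt ξ 0 with hξ | hξ
            · simp [Set.Ioo_eq_empty_of_le hξ]
            · simp only [hQ, ← add_assoc]
              have := lintegral_resonance_le hα hξ (τ - t + μ ^ 2 / ξ) (μ / ξ) hwm
              simpa only [← add_assoc] using this
          · have : Measurable fun x => ∫⁻ y, w (τ - t + μ ^ 2 / ξ + Q x y) :=
              Measurable.lintegral_prod_right' (f := fun z : ℝ × ℝ =>
                w (τ - t + μ ^ 2 / ξ + Q z.1 z.2)) (by fun_prop)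
            fun_prop
      _ = _ := by
          rw [lintegral_mul_const _ hwm]
          ring
  · have : Measurable fun z : ℝ × ℝ => ∫⁻ y, w (τ - z.2 + μ ^ 2 / ξ + Q z.1 y) :=
      Measurable.lintegral_prod_right' (f := fun z : (ℝ × ℝ) × ℝ =>
        w (τ - z.1.2 + μ ^ 2 / ξ + Q z.1.1 z.2)) (by fun_prop)
    simp only [Function.uncurry_def]
    exact Measurable.aemeasurable (by fun_prop)

/-- Bilinear Cauchy–Schwarz argument for the `L⁴` norm of a Fourier transform. -/
theorem eLpNorm_fourier_four_le_of_multiplier {V : Type*} [NormedAddCommGroup V]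
    [InnerProductSpace ℝ V] [FiniteDimensional ℝ V] [MeasurableSpace V] [BorelSpace V]
    {f : V → ℂ} (hf : Integrable f) {m H : V → ENNReal} (hm : Measurable m) (hH : Measurable H)
    (hfm : ∀ q, ‖f q‖ₑ ^ 2 ≤ m q * H q) {K : ENNReal} (hK : ∀ p, ∫⁻ q, m q * m (p - q) ≤ K) :
    eLpNorm (𝓕 f) 4 ^ 4 ≤ K * (∫⁻ q, H q) ^ 2 := by
  have hsq : ∀ z : ENNReal, (z ^ (1 / 2 : ℝ)) ^ (2 : ℝ) = z := fun z => by
    rw [← ENNReal.rpow_mul]; norm_num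
  have hcs : ∀ p, (∫⁻ q, ‖f q‖ₑ * ‖f (p - q)‖ₑ) ^ 2 ≤ K * ∫⁻ q, H q * H (p - q) := by
    intro p
    have h1 : ∫⁻ q, ‖f q‖ₑ * ‖f (p - q)‖ₑ ≤
        ∫⁻ q, (m q * m (p - q)) ^ (1 / 2 : ℝ) * (H q * H (p - q)) ^ (1 / 2 : ℝ) := by
      refine lintegral_mono fun q => ?_
      rw [← ENNReal.mul_rpow_of_nonneg _ _ (by norm_num), one_div,
        ENNReal.le_rpow_inv_iff two_pos]
      calc (‖f q‖ₑ * ‖f (p - q)‖ₑ) ^ (2 : ℝ) = ‖f q‖ₑ ^ 2 * ‖f (p - q)‖ₑ ^ 2 := by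
            rw [← mul_pow]; exact_mod_cast ENNReal.rpow_natCast _ 2
        _ ≤ (m q * H q) * (m (p - q) * H (p - q)) := mul_le_mul' (hfm _) (hfm _)
        _ = _ := by ring
    have h2 := ENNReal.lintegral_mul_le_Lp_mul_Lq volume (p := 2) (q := 2)
      (Real.HolderConjugate.two_two)
      (f := fun q => (m q * m (p - q)) ^ (1 / 2 : ℝ))
      (g := fun q => (H q * H (p - q)) ^ (1 / 2 : ℝ)) (by fun_prop) (by fun_prop)
    simp only [hsq, Pi.mul_apply] at h2
    calc (∫⁻ q, ‖f q‖ₑ * ‖f (p - q)‖ₑ) ^ 2 ≤ ((∫⁻ q, m q * m (p - q)) ^ (1 / 2 : ℝ) *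
          (∫⁻ q, H q * H (p - q)) ^ (1 / 2 : ℝ)) ^ 2 := by
          gcongr
          exact h1.trans h2
      _ = (∫⁻ q, m q * m (p - q)) * ∫⁻ q, H q * H (p - q) := by
          rw [mul_pow, ← ENNReal.rpow_natCast, ← ENNReal.rpow_natCast]
          exact_mod_cast congrArg₂ (· * ·) (hsq _) (hsq _)
      _ ≤ _ := by gcongr; exact hK p
  refine (eLpNorm_fourier_four_le hf).trans ((lintegral_mono hcs).trans (le_of_eq ?_))
  have hswap : ∫⁻ p, ∫⁻ q, H q * H (p - q) = (∫⁻ q, H q) ^ 2 := by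
    rw [lintegral_lintegral_swap (by simp only [Function.uncurry_def]; fun_prop)]
    have : ∀ q, ∫⁻ p, H q * H (p - q) = H q * ∫⁻ p, H p := fun q => by
      rw [lintegral_const_mul _ (by fun_prop), lintegral_sub_right_eq_self]
    simp only [this]
    rw [lintegral_mul_const _ hH, sq]
  rw [lintegral_const_mul, hswap]
  exact Measurable.lintegral_prod_right' (f := fun z : V × V => H z.2 * H (z.1 - z.2)) (by fun_prop)

theorem fourierInv_eq_zero_of_not_integrable {V : Type*} [NormedAddCommGroup V]
    [InnerProductSpace ℝ V] [FiniteDimensional ℝ V] [MeasurableSpace V] [BorelSpace V] {f : V → ℂ}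
    (hf : ¬ Integrable f) : 𝓕⁻ f = 0 := by
  ext w
  rw [Real.fourierInv_eq_fourier_neg, Real.fourier_eq]
  exact integral_undef fun h => hf ((Real.fourierIntegral_convergent_iff _).1 h)

theorem fourier_add_of_integrable {V : Type*} [NormedAddCommGroup V]
    [InnerProductSpace ℝ V] [FiniteDimensional ℝ V] [MeasurableSpace V] [BorelSpace V]
    {f g : V → ℂ} (hf : Integrable f) (hg : Integrable g) : 𝓕 (f + g) = 𝓕 f + 𝓕 g := by
  ext w
  simp only [Real.fourier_eq, Pi.add_apply, smul_add]
  exact integral_add ((Real.fourierIntegral_convergent_iff w).2 hf)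
    ((Real.fourierIntegral_convergent_iff w).2 hg)

theorem enorm_rpow_mul_sq_eq {α b s x : ℝ} (hx : x ≠ 0) (z : ℂ) :
    ‖((|x| ^ ((α - 2) / 8) : ℝ) : ℂ) * z‖ₑ ^ 2 =
      ENNReal.ofReal (|x| ^ ((α - 2) / 4)) * modulationWeight b s *
        ‖(((1 + |s|) ^ b : ℝ) : ℂ) * z‖ₑ ^ 2 := by
  have hx0 : 0 < |x| := abs_pos.2 hx
  have hs : 0 < 1 + |s| := by positivity
  have e : ∀ r : ℝ, 0 ≤ r → ‖(r : ℂ)‖ₑ = ENNReal.ofReal r := fun r hr => by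
    rw [← ofReal_norm, Complex.norm_real, Real.norm_of_nonneg hr]
  unfold modulationWeight
  rw [enorm_mul, enorm_mul, e _ (by positivity), e _ (by positivity), mul_pow, mul_pow,
    ← mul_assoc, ← ENNReal.ofReal_pow (by positivity), ← ENNReal.ofReal_pow (by positivity),
    ← ENNReal.ofReal_mul (by positivity), ← ENNReal.ofReal_mul (by positivity)]
  congr 2
  rw [← Real.rpow_natCast, ← Real.rpow_natCast, ← Real.rpow_mul hx0.le, ← Real.rpow_mul hs.le,
    mul_assoc, ← Real.rpow_add hs, show -(2 * b) + b * ((2 : ℕ) : ℝ) = 0 by push_cast; ring,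
    Real.rpow_zero, mul_one]
  congr 1
  push_cast
  ring

theorem eLpNorm_fourier_four_le_mul {V : Type*} [NormedAddCommGroup V]
    [InnerProductSpace ℝ V] [FiniteDimensional ℝ V] [MeasurableSpace V] [BorelSpace V]
    {f G : V → ℂ} (hf : Integrable f) (hG : Measurable G) {m : V → ENNReal} (hm : Measurable m)
    (hfm : ∀ q, ‖f q‖ₑ ^ 2 ≤ m q * ‖G q‖ₑ ^ 2) {K : ENNReal}
    (hK : ∀ p, ∫⁻ q, m q * m (p - q) ≤ K) :
    eLpNorm (𝓕 f) 4 ≤ K ^ (1 / 4 : ℝ) * eLpNorm G 2 := by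
  have h := eLpNorm_fourier_four_le_of_multiplier hf hm (H := fun q => ‖G q‖ₑ ^ 2)
    (by fun_prop) hfm hK
  have h2 : ∫⁻ q, ‖G q‖ₑ ^ 2 = eLpNorm G 2 ^ 2 := by
    have := eLpNorm_nnreal_pow_eq_lintegral (f := G) (μ := volume) (p := 2) (by norm_num)
    norm_num at this
    exact_mod_cast this.symm
  have h4 : (K ^ (1 / 4 : ℝ)) ^ 4 = K := by
    rw [← ENNReal.rpow_natCast, ← ENNReal.rpow_mul]
    norm_num
  rw [h2, ← pow_mul] at h
  refine (ENNReal.pow_right_strictMono (n := 4) (by norm_num)).le_iff_le.1 ?_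
  simpa only [mul_pow, h4, ← pow_mul] using h

theorem lintegral_posMultiplier_euclideanSpace_le {α b : ℝ} (hα : 4 ≤ α)
    (p : EuclideanSpace ℝ (Fin 3)) :
    ∫⁻ q : EuclideanSpace ℝ (Fin 3), posMultiplier α b (q 0) (q 1) (q 2) *
        posMultiplier α b ((p - q) 0) ((p - q) 1) ((p - q) 2) ≤
      ENNReal.ofReal (4 * 2 ^ ((α - 1) / 2)) * (∫⁻ s, modulationWeight b s) ^ 2 := by
  have hM := measurable_posMultiplier α b
  refine le_trans (le_of_eq ?_) (lintegral_posMultiplier_le (b := b) hα (p 0) (p 1) (p 2))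
  refine lintegral_euclideanSpace_fin_three (G := fun x y t =>
    posMultiplier α b x y t * posMultiplier α b (p 0 - x) (p 1 - y) (p 2 - t)) (hM.mul ?_)
  exact hM.comp (f := fun z : ℝ × ℝ × ℝ => (p 0 - z.1, p 1 - z.2.1, p 2 - z.2.2)) (by fun_prop)

/-- The `L⁴` estimate, stated through the pointwise identity relating `F` to the weighted
function `G`. -/
theorem eLpNorm_fourierInv_four_le {α b : ℝ} (hα : 4 ≤ α) {F G : EuclideanSpace ℝ (Fin 3) → ℂ}
    (hFi : Integrable F) (hGm : Measurable G) (hF0 : ∀ q, q 0 = 0 → F q = 0)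
    (hFG : ∀ q, q 0 ≠ 0 → ‖F q‖ₑ ^ 2 = ENNReal.ofReal (|q 0| ^ ((α - 2) / 4)) *
      modulationWeight b (q 2 + phi α (q 0) (q 1)) * ‖G q‖ₑ ^ 2) :
    eLpNorm (𝓕⁻ F) 4 ≤ 2 * (ENNReal.ofReal (4 * 2 ^ ((α - 1) / 2)) *
      (∫⁻ s, modulationWeight b s) ^ 2) ^ (1 / 4 : ℝ) * eLpNorm G 2 := by
  set K : ENNReal :=
    ENNReal.ofReal (4 * 2 ^ ((α - 1) / 2)) * (∫⁻ s, modulationWeight b s) ^ 2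
  have hpos : MeasurableSet {p : EuclideanSpace ℝ (Fin 3) | 0 < p 0} :=
    measurableSet_lt measurable_const (by fun_prop)
  have hneg : MeasurableSet {p : EuclideanSpace ℝ (Fin 3) | p 0 < 0} :=
    measurableSet_lt (by fun_prop) measurable_const
  set m : EuclideanSpace ℝ (Fin 3) → ENNReal := fun q => posMultiplier α b (q 0) (q 1) (q 2) with hm
  have hmm : Measurable m := (measurable_posMultiplier α b).comp
    (f := fun q : EuclideanSpace ℝ (Fin 3) => (q 0, q 1, q 2)) (by fun_prop)
  have hmK : ∀ p, ∫⁻ q, m q * m (p - q) ≤ K := lintegral_posMultiplier_euclideanSpace_le hα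
  have hmK' : ∀ p, ∫⁻ q, m (-q) * m (-(p - q)) ≤ K := fun p => by
    refine le_trans (le_of_eq ?_) (hmK (-p))
    rw [← lintegral_neg_eq_self]
    refine lintegral_congr fun q => ?_
    congr 2 <;> abel
  have hsplit : F = {p | 0 < p 0}.indicator F + {p | p 0 < 0}.indicator F := by
    ext p
    rcases lt_trichotomy (p 0) 0 with h | h | h
    · simp [h, h.le]
    · simp [h, hF0 p h]
    · simp [h, h.le]
  have h1 : eLpNorm (𝓕 ({p | 0 < p 0}.indicator F)) 4 ≤ K ^ (1 / 4 : ℝ) * eLpNorm G 2 := by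
    refine eLpNorm_fourier_four_le_mul (hFi.indicator hpos) hGm hmm (fun q => ?_) hmK
    by_cases h : 0 < q 0
    · rw [Set.indicator_of_mem (show q ∈ {p | 0 < p 0} from h)]
      refine (hFG q h.ne').le.trans ?_
      simp only [hm, posMultiplier]
      rw [Set.indicator_of_mem (show q 0 ∈ Set.Ioi 0 from h), abs_of_pos h]
    · simp [h]
  have h2 : eLpNorm (𝓕 ({p | p 0 < 0}.indicator F)) 4 ≤ K ^ (1 / 4 : ℝ) * eLpNorm G 2 := by
    refine eLpNorm_fourier_four_le_mul (hFi.indicator hneg) hGm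
      (m := fun q => m (-q)) (by fun_prop) (fun q => ?_) hmK'
    by_cases h : q 0 < 0
    · rw [Set.indicator_of_mem (show q ∈ {p | p 0 < 0} from h)]
      refine (hFG q h.ne).le.trans ?_
      have hphi : -q 2 + phi α (-q 0) (-q 1) = -(q 2 + phi α (q 0) (q 1)) := by
        simp only [phi, abs_neg, neg_sq, div_neg]
        ring
      simp only [hm, posMultiplier, PiLp.neg_apply]
      rw [Set.indicator_of_mem (show -q 0 ∈ Set.Ioi 0 from by simpa using h), hphi,
        abs_of_neg h]
      simp only [modulationWeight, abs_neg]
      exact le_rfl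
    · simp [h]
  have hFp := hFi.indicator hpos
  have hFn := hFi.indicator hneg
  have hadd : 𝓕 F = 𝓕 ({p | 0 < p 0}.indicator F) + 𝓕 ({p | p 0 < 0}.indicator F) := by
    rw [← fourier_add_of_integrable hFp hFn, ← hsplit]
  rw [eLpNorm_fourierInv_eq_eLpNorm_fourier hFi, hadd]
  rw [two_mul, add_mul]
  exact (eLpNorm_add_le (continuous_fourier_of_integrable hFp).aestronglyMeasurable
    (continuous_fourier_of_integrable hFn).aestronglyMeasurable (by norm_num)).trans
    (add_le_add h1 h2)

/-- **Paper's Lemma 2.3, a Strichartz-type estimate.**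
For `α ≥ 4` and `b > 1/2` there is `C > 0` such that for every measurable
`g : ℝ³ → ℂ`, the function `u = 𝓕⁻¹ g` satisfies
`‖ |D_x|^{(α−2)/8} u ‖_{L⁴(ℝ³)} ≤ C ‖⟨τ + φ(ξ, μ)⟩^b g‖_{L²(ℝ³)}`,
where `|D_x|^{(α−2)/8} u` is the inverse Fourier transform of `|ξ|^{(α−2)/8} g`.
(If the right-hand side is infinite the inequality holds trivially, so the
finiteness hypothesis `‖⟨σ⟩^b g‖_{L²} < ∞` is subsumed.) -/
theorem stmt11 (α b : ℝ) (hα : 4 ≤ α) (hb : 1 / 2 < b) :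
    ∃ C : ℝ, 0 < C ∧ ∀ g : EuclideanSpace ℝ (Fin 3) → ℂ, Measurable g →
      eLpNorm (𝓕⁻ (fun p : EuclideanSpace ℝ (Fin 3) =>
          ((|p 0| ^ ((α - 2) / 8) : ℝ) : ℂ) * g p)) 4 volume ≤
        ENNReal.ofReal C *
          eLpNorm (fun p : EuclideanSpace ℝ (Fin 3) =>
            (((1 + |p 2 + phi α (p 0) (p 1)|) ^ b : ℝ) : ℂ) * g p) 2 volume := by
  set K : ENNReal :=
    ENNReal.ofReal (4 * 2 ^ ((α - 1) / 2)) * (∫⁻ s, modulationWeight b s) ^ 2 with hK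
  have hKtop : K ^ (1 / 4 : ℝ) ≠ ⊤ :=
    ENNReal.rpow_ne_top_of_nonneg (by norm_num) (ENNReal.mul_ne_top ENNReal.ofReal_ne_top
      (ENNReal.pow_ne_top (lintegral_modulationWeight_lt_top hb).ne))
  refine ⟨2 * (K ^ (1 / 4 : ℝ)).toReal + 1, by positivity, fun g hg => ?_⟩
  by_cases hFi : Integrable (fun p : EuclideanSpace ℝ (Fin 3) =>
      ((|p 0| ^ ((α - 2) / 8) : ℝ) : ℂ) * g p)
  swap
  · simp [fourierInv_eq_zero_of_not_integrable hFi]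
  have h8 : (α - 2) / 8 ≠ 0 := by linarith
  refine (eLpNorm_fourierInv_four_le (b := b) hα hFi ?_
    (fun q h => by simp [h, Real.zero_rpow h8]) (fun q h => enorm_rpow_mul_sq_eq h (g q))).trans ?_
  · unfold phi
    fun_prop
  · gcongr
    rw [← hK, ← ENNReal.ofReal_toReal (ENNReal.mul_ne_top ENNReal.ofNat_ne_top hKtop)]
    apply ENNReal.ofReal_le_ofReal
    simp
end

section
/- Let s < 0 and N ≥ 100, and define M(ξ) = 1 for |ξ| < N and M(ξ) = (|ξ|/N)^s for |ξ| ≥ N. There exists C > 0 depending only on s (independent of N) such that for all ξ₁, ξ₂ ∈ ℝ with ξ = ξ₁ + ξ₂: M(ξ) / (M(ξ₁) M(ξ₂)) ≤ C ⟨ξ⟩^{s} / (⟨ξ₁⟩^{s} ⟨ξ₂⟩^{s}). (Multiplier inequality (3.0159), used in the proof of Lemma 3.3.) -/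
/-- The I-method multiplier: `M(ξ) = 1` if `|ξ| < N`, `M(ξ) = (|ξ|/N)^s` if `|ξ| ≥ N`. -/
noncomputable def Mmul (s N ξ : ℝ) : ℝ := if |ξ| < N then 1 else (|ξ| / N) ^ s

theorem Mmul_eq_max_rpow {s N : ℝ} (hN : 0 < N) (ξ : ℝ) :
    Mmul s N ξ = (max 1 (|ξ| / N)) ^ s := by
  unfold Mmul
  split_ifs with h
  · rw [max_eq_left ((div_le_one hN).2 h.le), Real.one_rpow]
  · rw [max_eq_right ((one_le_div hN).2 (not_lt.1 h))]

theorem max_one_div_le_one_add {N x : ℝ} (hN : 1 ≤ N) (hx : 0 ≤ x) :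
    max 1 (x / N) ≤ 1 + x :=
  max_le (by linarith) ((div_le_self hx hN).trans (by linarith))

theorem one_add_div_le_two_mul_max {N x : ℝ} (hN : 1 ≤ N) :
    (1 + x) / N ≤ 2 * max 1 (x / N) := by
  have h₁ : 1 / N ≤ 1 := (div_le_one (by linarith)).2 hN
  rw [add_div]
  linarith [le_max_left 1 (x / N), le_max_right 1 (x / N)]

theorem max_mul_max_mul_le_of_le {N a b c : ℝ} (hN : 1 ≤ N) (ha : N ≤ a) (hb : 0 ≤ b) :
    max 1 (a / N) * max 1 (b / N) * (1 + c) ≤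
      2 * max 1 (c / N) * ((1 + a) * (1 + b)) := by
  have hN₀ : 0 < N := by linarith
  have ha₀ : 0 ≤ a := by linarith
  rw [max_eq_right ((one_le_div hN₀).2 ha)]
  calc a / N * max 1 (b / N) * (1 + c)
      = (1 + c) / N * (a * max 1 (b / N)) := by ring
    _ ≤ 2 * max 1 (c / N) * ((1 + a) * (1 + b)) := by
      gcongr
      · exact one_add_div_le_two_mul_max hN
      · linarith
      · exact max_one_div_le_one_add hN hb

theorem max_mul_max_mul_le {N a b c : ℝ} (hN : 1 ≤ N) (ha : 0 ≤ a) (hb : 0 ≤ b)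
    (hc : 0 ≤ c) (habc : c ≤ a + b) :
    max 1 (a / N) * max 1 (b / N) * (1 + c) ≤
      2 * max 1 (c / N) * ((1 + a) * (1 + b)) := by
  have hN₀ : 0 < N := by linarith
  rcases le_total N a with hNa | hNa
  · exact max_mul_max_mul_le_of_le hN hNa hb
  rcases le_total N b with hNb | hNb
  · have h := max_mul_max_mul_le_of_le (c := c) hN hNb ha
    rwa [mul_comm (max 1 (b / N)), mul_comm (1 + b)] at h
  rw [max_eq_left ((div_le_one hN₀).2 hNa), max_eq_left ((div_le_one hN₀).2 hNb)]
  have hab : 1 + c ≤ (1 + a) * (1 + b) := by nlinarith [mul_nonneg ha hb]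
  nlinarith [le_max_left 1 (c / N)]

/-- **Multiplier inequality (3.0159), used in the proof of Lemma 3.3.**
For `s < 0` there is `C > 0` depending only on `s` (independent of `N ≥ 100`) such that
for all `ξ₁, ξ₂` with `ξ = ξ₁ + ξ₂`,
`M(ξ)/(M(ξ₁)M(ξ₂)) ≤ C ⟨ξ⟩^s / (⟨ξ₁⟩^s ⟨ξ₂⟩^s)`. -/
theorem stmt15 (s : ℝ) (hs : s < 0) :
    ∃ C : ℝ, 0 < C ∧ ∀ N : ℝ, 100 ≤ N → ∀ ξ₁ ξ₂ : ℝ,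
      Mmul s N (ξ₁ + ξ₂) / (Mmul s N ξ₁ * Mmul s N ξ₂) ≤
        C * ((1 + |ξ₁ + ξ₂|) ^ s / ((1 + |ξ₁|) ^ s * (1 + |ξ₂|) ^ s)) := by
  refine ⟨(1 / 2 : ℝ) ^ s, by positivity, fun N hN ξ₁ ξ₂ => ?_⟩
  have hN₀ : 0 < N := by linarith
  simp only [Mmul_eq_max_rpow hN₀]
  have hm (x : ℝ) : 0 < max 1 (x / N) := lt_max_of_lt_left one_pos
  have hm₁ := hm |ξ₁|
  have hm₂ := hm |ξ₂|
  have hm₃ := hm |ξ₁ + ξ₂|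
  rw [← Real.mul_rpow hm₁.le hm₂.le, ← Real.div_rpow hm₃.le (by positivity),
    ← Real.mul_rpow (by positivity) (by positivity),
    ← Real.div_rpow (by positivity) (by positivity),
    ← Real.mul_rpow (by positivity) (by positivity)]
  refine Real.rpow_le_rpow_of_nonpos (by positivity) ?_ hs.le
  have key := max_mul_max_mul_le (N := N) (by linarith) (abs_nonneg ξ₁) (abs_nonneg ξ₂)
    (abs_nonneg (ξ₁ + ξ₂)) (abs_add_le ξ₁ ξ₂)
  rw [← mul_div_assoc, div_le_div_iff₀ (by positivity) (by positivity)]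
  linarith
end

section
/- Let α ≥ 4 be real and fix ξ ≠ 0, μ, τ ∈ ℝ. On the open set {(ξ₁, μ₁) ∈ ℝ² : ξ₁ ≠ 0 and ξ₂ := ξ − ξ₁ ≠ 0}, define Ψ(ξ₁, μ₁) = (Δ, ν) where Δ = ξ|ξ|^α − ξ₁|ξ₁|^α − ξ₂|ξ₂|^α and ν = τ + φ(ξ₁, μ₁) + φ(ξ₂, μ₂) with μ₂ = μ − μ₁. Then Ψ is differentiable and the absolute value of its Jacobian determinant equals 2(α+1) · | |ξ₁|^α − |ξ₂|^α | · | μ₁/ξ₁ − μ₂/ξ₂ |. (Paper's Jacobian computation (2.013)/(3.010).) -/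
open ContinuousLinearMap in
theorem det_prod_smul_fst_add_smul_snd (a b c d : ℝ) :
    LinearMap.det (((a • fst ℝ ℝ ℝ + b • snd ℝ ℝ ℝ).prod (c • fst ℝ ℝ ℝ + d • snd ℝ ℝ ℝ) :
      ℝ × ℝ →L[ℝ] ℝ × ℝ) : ℝ × ℝ →ₗ[ℝ] ℝ × ℝ) = a * d - b * c := by
  rw [← LinearMap.det_toMatrix (Module.Basis.finTwoProd ℝ), Matrix.det_fin_two]
  simp [LinearMap.toMatrix_apply]

theorem hasDerivAt_mul_abs_rpow {α x : ℝ} (hα : 1 < α) :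
    HasDerivAt (fun y : ℝ => y * |y| ^ α) ((α + 1) * |x| ^ α) x := by
  refine ((hasDerivAt_id x).mul (hasDerivAt_abs_rpow x hα)).congr_deriv ?_
  have h : |x| ^ α = |x| ^ (α - 2) * x ^ 2 := by
    rcases eq_or_ne x 0 with rfl | hx
    · simp [Real.zero_rpow (by linarith : α ≠ 0)]
    · rw [← sq_abs x, ← Real.rpow_natCast, ← Real.rpow_add (abs_pos.mpr hx)]
      simp
  simp only [id, h]
  ring

open ContinuousLinearMap in
theorem hasFDerivAt_phi {α x m : ℝ} (hα : 1 < α) (hx : x ≠ 0) :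
    HasFDerivAt (fun p : ℝ × ℝ => phi α p.1 p.2)
      (((α + 1) * |x| ^ α - m ^ 2 / x ^ 2) • fst ℝ ℝ ℝ + (2 * m / x) • snd ℝ ℝ ℝ) (x, m) := by
  have hf : HasFDerivAt (fun p : ℝ × ℝ => p.1) (fst ℝ ℝ ℝ) (x, m) := hasFDerivAt_fst
  have hs : HasFDerivAt (fun p : ℝ × ℝ => p.2) (snd ℝ ℝ ℝ) (x, m) := hasFDerivAt_snd
  have h₁ := (hasDerivAt_mul_abs_rpow (x := x) hα).comp_hasFDerivAt (x, m) hf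
  have h₂ := (hs.pow 2).mul ((hasDerivAt_inv hx).comp_hasFDerivAt (x, m) hf)
  refine (h₁.add h₂).congr_fderiv ?_
  ext <;> simp <;> field_simp <;> ring

/-- **Paper's Jacobian computation (2.013)/(3.010).**
Fix `α ≥ 4`, `ξ ≠ 0`, `μ`, `τ`.  On `{(ξ₁, μ₁) : ξ₁ ≠ 0, ξ₂ := ξ − ξ₁ ≠ 0}`, the map
`Ψ(ξ₁, μ₁) = (Δ, ν)` with `Δ = ξ|ξ|^α − ξ₁|ξ₁|^α − ξ₂|ξ₂|^α` and
`ν = τ + φ(ξ₁, μ₁) + φ(ξ₂, μ₂)`, `μ₂ = μ − μ₁`, is differentiable and the absolute value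
of its Jacobian determinant equals
`2(α+1) ||ξ₁|^α − |ξ₂|^α| |μ₁/ξ₁ − μ₂/ξ₂|`. -/
theorem stmt17 (α : ℝ) (hα : 4 ≤ α) (ξ μ τ : ℝ) (hξ : ξ ≠ 0)
    (ξ₁ μ₁ : ℝ) (h1 : ξ₁ ≠ 0) (h2 : ξ - ξ₁ ≠ 0) :
    ∃ L : ℝ × ℝ →L[ℝ] ℝ × ℝ,
      HasFDerivAt
        (fun p : ℝ × ℝ =>
          ((ξ * |ξ| ^ α - p.1 * |p.1| ^ α - (ξ - p.1) * |ξ - p.1| ^ α,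
            τ + phi α p.1 p.2 + phi α (ξ - p.1) (μ - p.2)) : ℝ × ℝ))
        L (ξ₁, μ₁) ∧
      |LinearMap.det (L : ℝ × ℝ →ₗ[ℝ] ℝ × ℝ)| =
        2 * (α + 1) * abs (|ξ₁| ^ α - |ξ - ξ₁| ^ α) * |μ₁ / ξ₁ - (μ - μ₁) / (ξ - ξ₁)| := by
  have hα' : 1 < α := by linarith
  let F := ContinuousLinearMap.fst ℝ ℝ ℝ
  let S := ContinuousLinearMap.snd ℝ ℝ ℝ
  have hf : HasFDerivAt (fun p : ℝ × ℝ => p.1) F (ξ₁, μ₁) := hasFDerivAt_fst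
  have hs : HasFDerivAt (fun p : ℝ × ℝ => p.2) S (ξ₁, μ₁) := hasFDerivAt_snd
  have hΔ := (((hasDerivAt_mul_abs_rpow hα').comp_hasFDerivAt (ξ₁, μ₁) hf).const_sub
    (ξ * |ξ| ^ α)).sub
      ((hasDerivAt_mul_abs_rpow hα').comp_hasFDerivAt (ξ₁, μ₁) (hf.const_sub ξ))
  have hν := ((hasFDerivAt_phi (m := μ₁) hα' h1).const_add τ).add
    ((hasFDerivAt_phi (m := μ - μ₁) hα' h2).comp (ξ₁, μ₁)
      ((hf.const_sub ξ).prodMk (hs.const_sub μ)))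
  let A := (α + 1) * (|ξ - ξ₁| ^ α - |ξ₁| ^ α)
  let C := ((α + 1) * |ξ₁| ^ α - μ₁ ^ 2 / ξ₁ ^ 2)
    - ((α + 1) * |ξ - ξ₁| ^ α - (μ - μ₁) ^ 2 / (ξ - ξ₁) ^ 2)
  let D := 2 * (μ₁ / ξ₁ - (μ - μ₁) / (ξ - ξ₁))
  refine ⟨(A • F + (0 : ℝ) • S).prod (C • F + D • S), (hΔ.prodMk hν).congr_fderiv ?_, ?_⟩
  · ext <;> simp [A, C, D, F, S] <;> ring
  · rw [det_prod_smul_fst_add_smul_snd, zero_mul, sub_zero, abs_mul, abs_mul, abs_mul,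
      abs_of_pos (by linarith : 0 < α + 1), abs_two, abs_sub_comm (|ξ - ξ₁| ^ α)]
    ring
end
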